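/- arXiv:2107.12198 — 5 statements merged into one kernel-verified Lean document; each statement's English description precedes it below -/
import Mathlib

section
/- Let λ ∈ ℂ, k ≥ 1, ρ > 0 and M ≥ 0, and let p ∈ ℂ[X] be a polynomial such that |p(z)| ≤ M for all z ∈ ℂ with |z − λ| ≤ ρ. Then for all indices 1 ≤ i ≤ j ≤ k, the (i,j) entry of p(J_k(λ)) satisfies |(p(J_k(λ)))_{i,j}| ≤ M/ρ^{j−i}, and all entries with i > j are zero. -/
/-- The `k × k` Jordan block with eigenvalue `lam`: `lam` on the diagonal, `1` on the
first superdiagonal and `0` elsewhere. -/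
def jordanBlock (k : ℕ) (lam : ℂ) : Matrix (Fin k) (Fin k) ℂ :=
  fun i j => if (j : ℕ) = i then lam else if (j : ℕ) = (i : ℕ) + 1 then 1 else 0

theorem jordanBlock_zero_pow (k : ℕ) (n : ℕ) (i j : Fin k) :
    (jordanBlock k 0 ^ n) i j = if (j : ℕ) = i + n then 1 else 0 := by
  induction n generalizing i j with
  | zero => simp [Matrix.one_apply, Fin.ext_iff, eq_comm]
  | succ n ih =>
    rw [pow_succ, Matrix.mul_apply]
    simp only [ih, jordanBlock]
    by_cases h : (i : ℕ) + n < k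
    · rw [Finset.sum_eq_single (⟨i + n, h⟩ : Fin k)]
      · simp; grind
      · intro b _ hb
        rw [if_neg (fun h' => hb (Fin.ext h')), zero_mul]
      · simp
    · rw [Finset.sum_eq_zero]
      · rw [if_neg]; omega
      · intro x _
        rw [if_neg, zero_mul]; omega

theorem aeval_jordanBlock_zero (k : ℕ) (q : Polynomial ℂ) (i j : Fin k) :
    Polynomial.aeval (jordanBlock k 0) q i j =
      if (i : ℕ) ≤ j then q.coeff ((j : ℕ) - i) else 0 := by
  induction q using Polynomial.induction_on' with
  | add p q hp hq => rw [map_add, Matrix.add_apply, hp, hq]; split_ifs <;> simp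
  | monomial n a =>
    rw [Polynomial.aeval_monomial, ← Algebra.smul_def, Matrix.smul_apply, jordanBlock_zero_pow,
      Polynomial.coeff_monomial]
    split_ifs <;> first | omega | simp

theorem aeval_jordanBlock (k : ℕ) (lam : ℂ) (p : Polynomial ℂ) (i j : Fin k) :
    Polynomial.aeval (jordanBlock k lam) p i j =
      if (i : ℕ) ≤ j then (Polynomial.taylor lam p).coeff ((j : ℕ) - i) else 0 := by
  rw [← aeval_jordanBlock_zero, Polynomial.taylor_apply, Polynomial.aeval_comp]
  congr 2
  have : jordanBlock k lam = jordanBlock k 0 + algebraMap ℂ _ lam := by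
    ext a b
    simp only [jordanBlock, Matrix.add_apply, Matrix.algebraMap_matrix_apply, Fin.ext_iff]
    split_ifs <;> first | omega | simp
  simp [this]

theorem iteratedDeriv_poly (p : Polynomial ℂ) (n : ℕ) :
    iteratedDeriv n (fun z => p.eval z) = fun z => (Polynomial.derivative^[n] p).eval z := by
  induction n with
  | zero => simp
  | succ n ih =>
    rw [iteratedDeriv_succ, ih, Function.iterate_succ_apply']
    ext z
    simp

theorem poly_jordanBlock_entry_bound (k : ℕ) (hk : 1 ≤ k) (lam : ℂ)
    (ρ M : ℝ) (hρ : 0 < ρ) (hM : 0 ≤ M) (p : Polynomial ℂ)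
    (hp : ∀ z : ℂ, ‖z - lam‖ ≤ ρ → ‖p.eval z‖ ≤ M) :
    (∀ i j : Fin k, (i : ℕ) ≤ (j : ℕ) →
        ‖Polynomial.aeval (jordanBlock k lam) p i j‖ ≤ M / ρ ^ ((j : ℕ) - (i : ℕ))) ∧
      (∀ i j : Fin k, (j : ℕ) < (i : ℕ) →
        Polynomial.aeval (jordanBlock k lam) p i j = 0) := by
  refine ⟨fun i j hij => ?_, fun i j hij => ?_⟩
  · rw [aeval_jordanBlock, if_pos hij]
    generalize (j : ℕ) - (i : ℕ) = n
    have h := Complex.norm_iteratedDeriv_le_of_forall_mem_sphere_norm_le (c := lam) (R := ρ)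
      (C := M) (f := fun z => p.eval z) n hρ p.differentiable.diffContOnCl
      (fun z hz => hp z (by rw [mem_sphere_iff_norm] at hz; exact hz.le))
    rw [iteratedDeriv_poly, ← Polynomial.factorial_smul_hasseDeriv] at h
    rw [Polynomial.taylor_coeff]
    have hf : (0 : ℝ) < n.factorial := by exact_mod_cast n.factorial_pos
    simp only [LinearMap.smul_apply] at h
    simp only [nsmul_eq_mul, Polynomial.eval_mul, Polynomial.eval_natCast,
      norm_mul, Complex.norm_natCast, mul_div_assoc] at h
    exact le_of_mul_le_mul_left h hf
  · rw [aeval_jordanBlock, if_neg (by omega)]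
end

section
/- Let λ ∈ ℂ, k ≥ 1, ρ > 0 and M ≥ 0, and let p ∈ ℂ[X] satisfy |p(z)| ≤ M for all z ∈ ℂ with |z − λ| ≤ ρ. Let P_k(ρ) ∈ ℝ^{k×k} be the upper triangular Toeplitz matrix with (i,j) entry ρ^{−(j−i)} for i ≤ j and 0 for i > j. Then ‖p(J_k(λ))‖_F ≤ M · ‖P_k(ρ)‖_F, where ‖·‖_F denotes the Frobenius norm. -/
/-- The Frobenius norm of a square matrix over `ℝ` or `ℂ`. -/
noncomputable def frobNorm {k : ℕ} {𝕜 : Type*} [RCLike 𝕜]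
    (M : Matrix (Fin k) (Fin k) 𝕜) : ℝ :=
  Real.sqrt (∑ i, ∑ j, ‖M i j‖ ^ 2)

/-- The upper triangular Toeplitz matrix `P_k(ρ)` with `(i,j)` entry `ρ^(-(j-i))`
for `i ≤ j` and `0` otherwise. -/
noncomputable def Pmat (k : ℕ) (ρ : ℝ) : Matrix (Fin k) (Fin k) ℝ :=
  fun i j =>
    if (i : ℕ) ≤ (j : ℕ) then ρ ^ (-(((j : ℕ) - (i : ℕ) : ℕ) : ℤ)) else 0


open Polynomial in
lemma nilp_pow_apply (k : ℕ) (n : ℕ) (i j : Fin k) :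
    ((jordanBlock k 0) ^ n) i j = if (j : ℕ) = i + n then 1 else 0 := by
  induction n generalizing i j with
  | zero => simp [Matrix.one_apply, Fin.ext_iff, eq_comm]
  | succ n ih =>
    rw [pow_succ, Matrix.mul_apply]
    simp only [ih]
    have hJ : ∀ l : Fin k, jordanBlock k 0 l j = if (j : ℕ) = l + 1 then 1 else 0 := by
      intro l
      unfold jordanBlock
      split_ifs <;> first | rfl | omega
    simp only [hJ]
    split_ifs with h
    · rw [Finset.sum_eq_single (⟨i + n, by omega⟩ : Fin k)]
      · simp [h]; omega
      · intro b _ hb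
        rw [if_neg, zero_mul]
        intro h'; exact hb (Fin.ext h')
      · simp
    · apply Finset.sum_eq_zero
      intro l _
      split_ifs <;> first | omega | simp

open Polynomial in
lemma aeval_nilp_apply (k : ℕ) (q : ℂ[X]) (i j : Fin k) :
    (aeval (jordanBlock k 0) q) i j =
      if (i : ℕ) ≤ j then q.coeff ((j : ℕ) - i) else 0 := by
  induction q using Polynomial.induction_on' with
  | add p q hp hq => rw [map_add, Matrix.add_apply, hp, hq]; split_ifs <;> simp
  | monomial n a =>
    rw [aeval_monomial, ← Algebra.smul_def, Matrix.smul_apply, nilp_pow_apply, coeff_monomial]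
    split_ifs <;> first | omega | simp

open Polynomial in
lemma aeval_jordan (k : ℕ) (lam : ℂ) (p : ℂ[X]) :
    aeval (jordanBlock k lam) p = aeval (jordanBlock k 0) (taylor lam p) := by
  have h : jordanBlock k lam = jordanBlock k 0 + algebraMap ℂ _ lam := by
    ext i j
    rw [Matrix.add_apply, Matrix.algebraMap_matrix_apply]
    simp only [jordanBlock, Fin.ext_iff]
    split_ifs <;> first | omega | simp
  rw [taylor_apply, aeval_comp, h]
  simp

open Polynomial in
lemma iteratedDeriv_eval (p : ℂ[X]) (n : ℕ) :
    iteratedDeriv n (fun z => p.eval z) = fun z => (derivative^[n] p).eval z := by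
  induction n with
  | zero => simp
  | succ n ih =>
    rw [iteratedDeriv_succ, ih, Function.iterate_succ_apply']
    ext z; simp

open Polynomial in
lemma taylor_bound (lam : ℂ) (ρ M : ℝ) (hρ : 0 < ρ) (p : ℂ[X])
    (hp : ∀ z : ℂ, ‖z - lam‖ ≤ ρ → ‖p.eval z‖ ≤ M) (n : ℕ) :
    ‖(taylor lam p).coeff n‖ ≤ M * ρ ^ (-(n : ℤ)) := by
  have h := Complex.norm_iteratedDeriv_le_of_forall_mem_sphere_norm_le (f := fun z => p.eval z)
    (c := lam) (C := M) n hρ p.differentiable.diffContOnCl (by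
      intro z hz
      exact hp z (by rw [mem_sphere_iff_norm] at hz; exact hz.le))
  rw [iteratedDeriv_eval, ← factorial_smul_hasseDeriv] at h
  simp only [LinearMap.smul_apply, eval_smul] at h
  rw [taylor_coeff]
  have hf : (0 : ℝ) < n.factorial := by positivity
  rw [nsmul_eq_mul, norm_mul, Complex.norm_natCast, mul_div_assoc] at h
  have := le_of_mul_le_mul_left h hf
  rwa [zpow_neg, zpow_natCast, ← div_eq_mul_inv]

theorem poly_jordanBlock_frobenius_bound (k : ℕ) (hk : 1 ≤ k) (lam : ℂ)
    (ρ M : ℝ) (hρ : 0 < ρ) (hM : 0 ≤ M) (p : Polynomial ℂ)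
    (hp : ∀ z : ℂ, ‖z - lam‖ ≤ ρ → ‖p.eval z‖ ≤ M) :
    frobNorm (Polynomial.aeval (jordanBlock k lam) p) ≤ M * frobNorm (Pmat k ρ) := by
  unfold frobNorm
  rw [← Real.sqrt_sq hM, ← Real.sqrt_mul (sq_nonneg M)]
  apply Real.sqrt_le_sqrt
  rw [Finset.mul_sum]
  apply Finset.sum_le_sum
  intro i _
  rw [Finset.mul_sum]
  apply Finset.sum_le_sum
  intro j _
  rw [← mul_pow]
  apply pow_le_pow_left₀ (norm_nonneg _)
  rw [aeval_jordan, aeval_nilp_apply]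
  unfold Pmat
  split_ifs
  · rw [Real.norm_of_nonneg (by positivity)]
    exact taylor_bound lam ρ M hρ p hp _
  · simp
end

section
/- Fixing B_3 = X² in the degree-optimal recursion does not change the set of parameterized polynomials: for every choice of coefficients x_{a,k,j}, x_{b,k,j}, y_i ∈ ℂ there exist coefficients x'_{a,k,j}, x'_{b,k,j}, y'_i ∈ ℂ with x'_{a,1,1} = x'_{b,1,1} = 0 and x'_{a,1,2} = x'_{b,1,2} = 1 (so that the new B'_3 = X²) such that the output polynomial of the recursion with the new coefficients equals the output polynomial with the original coefficients. -/
/-- The polynomials `B_i` of the degree-optimal recursion: `B 1 = 1`, `B 2 = X`, and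
`B (k+2) = (∑ j = 1 .. k+1, xa k j • B j) * (∑ j = 1 .. k+1, xb k j • B j)`
(here expressed with index `k+3`, i.e. recursion step `k+1`). -/
noncomputable def Bpoly (xa xb : ℕ → ℕ → ℂ) : ℕ → Polynomial ℂ
  | 0 => 0
  | 1 => 1
  | 2 => Polynomial.X
  | (k + 3) =>
      (∑ j ∈ (Finset.Icc 1 (k + 2)).attach,
          Polynomial.C (xa (k + 1) j.1) * Bpoly xa xb j.1) *
      (∑ j ∈ (Finset.Icc 1 (k + 2)).attach,
          Polynomial.C (xb (k + 1) j.1) * Bpoly xa xb j.1)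
  termination_by i => i
  decreasing_by
    all_goals
      have := Finset.mem_Icc.mp j.2
      omega

/-- Change of coefficients replacing `B 3` by `c1 + c2 X + c3 X ^ 2`. -/
noncomputable def chg (c1 c2 c3 : ℂ) (x : ℕ → ℂ) (j : ℕ) : ℂ :=
  if j = 1 then x 1 + c1 * x 3 else if j = 2 then x 2 + c2 * x 3
  else if j = 3 then c3 * x 3 else x j

theorem chg_sum (c1 c2 c3 : ℂ) (x : ℕ → ℂ) (P Q : ℕ → Polynomial ℂ)
    (h1 : P 1 = Q 1) (h2 : P 2 = Q 2)
    (h3 : Q 3 = Polynomial.C c1 * P 1 + Polynomial.C c2 * P 2 + Polynomial.C c3 * P 3)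
    (n : ℕ) (h : ∀ j, 4 ≤ j → j ≤ n + 3 → P j = Q j) :
    ∑ j ∈ Finset.Icc 1 (n + 3), Polynomial.C (chg c1 c2 c3 x j) * P j =
      ∑ j ∈ Finset.Icc 1 (n + 3), Polynomial.C (x j) * Q j := by
  induction n with
  | zero =>
    have e : Finset.Icc 1 (0 + 3) = {1, 2, 3} := by decide
    rw [e]
    simp [chg, h3, ← h1, ← h2]
    ring
  | succ n ih =>
    rw [show n + 1 + 3 = (n + 3) + 1 by ring, Finset.sum_Icc_succ_top (b := n + 3) (by omega),
      Finset.sum_Icc_succ_top (b := n + 3) (by omega), ih (fun j a b => h j a (by omega)),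
      h (n + 3 + 1) (by omega) (by omega)]
    simp [chg]

theorem Bpoly_succ (xa xb : ℕ → ℕ → ℂ) (k : ℕ) : Bpoly xa xb (k + 3) =
    (∑ j ∈ Finset.Icc 1 (k + 2), Polynomial.C (xa (k + 1) j) * Bpoly xa xb j) *
    (∑ j ∈ Finset.Icc 1 (k + 2), Polynomial.C (xb (k + 1) j) * Bpoly xa xb j) := by
  rw [Bpoly, Finset.sum_attach (Finset.Icc 1 (k + 2))
      (fun j => Polynomial.C (xa (k + 1) j) * Bpoly xa xb j),
    Finset.sum_attach (Finset.Icc 1 (k + 2))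
      (fun j => Polynomial.C (xb (k + 1) j) * Bpoly xa xb j)]

theorem Bpoly_three (xa xb : ℕ → ℕ → ℂ) : Bpoly xa xb 3 =
    (Polynomial.C (xa 1 1) + Polynomial.C (xa 1 2) * Polynomial.X) *
    (Polynomial.C (xb 1 1) + Polynomial.C (xb 1 2) * Polynomial.X) := by
  have h := Bpoly_succ xa xb 0
  have e : Finset.Icc 1 (0 + 2) = {1, 2} := by decide
  rw [e] at h
  simpa [Bpoly.eq_2, Bpoly.eq_3] using h

theorem degopt_fix_B3_squared (m : ℕ) (hm : 1 ≤ m) (xa xb : ℕ → ℕ → ℂ)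
    (y : ℕ → ℂ) :
    ∃ (xa' xb' : ℕ → ℕ → ℂ) (y' : ℕ → ℂ),
      xa' 1 1 = 0 ∧ xb' 1 1 = 0 ∧ xa' 1 2 = 1 ∧ xb' 1 2 = 1 ∧
      (∑ i ∈ Finset.Icc 1 (m + 2), Polynomial.C (y' i) * Bpoly xa' xb' i) =
        (∑ i ∈ Finset.Icc 1 (m + 2), Polynomial.C (y i) * Bpoly xa xb i) := by
  obtain ⟨T, hT⟩ : ∃ T, T = chg (xa 1 1 * xb 1 1) (xa 1 1 * xb 1 2 + xa 1 2 * xb 1 1)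
    (xa 1 2 * xb 1 2) := ⟨_, rfl⟩
  obtain ⟨F, hF⟩ : ∃ F : (ℕ → ℕ → ℂ) → ℕ → ℕ → ℂ, F = fun x k j =>
    if k = 1 then (if j = 2 then 1 else 0) else T (x k) j := ⟨_, rfl⟩
  have h1 : Bpoly (F xa) (F xb) 1 = Bpoly xa xb 1 := by rw [Bpoly.eq_2, Bpoly.eq_2]
  have h2 : Bpoly (F xa) (F xb) 2 = Bpoly xa xb 2 := by rw [Bpoly.eq_3, Bpoly.eq_3]
  have h3 : Bpoly xa xb 3 = Polynomial.C (xa 1 1 * xb 1 1) * Bpoly (F xa) (F xb) 1 +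
      Polynomial.C (xa 1 1 * xb 1 2 + xa 1 2 * xb 1 1) * Bpoly (F xa) (F xb) 2 +
      Polynomial.C (xa 1 2 * xb 1 2) * Bpoly (F xa) (F xb) 3 := by
    rw [Bpoly_three, Bpoly_three, Bpoly.eq_2, Bpoly.eq_3]
    simp [hF]
    ring
  have key : ∀ j, 4 ≤ j → Bpoly (F xa) (F xb) j = Bpoly xa xb j := by
    intro j
    induction j using Nat.strong_induction_on with
    | _ j ih =>
      intro hj
      obtain ⟨k, rfl⟩ := Nat.exists_eq_add_of_le' hj
      have s := fun x : ℕ → ℂ => chg_sum _ _ _ x _ _ h1 h2 h3 k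
        (fun i a b => ih i (by omega) a)
      rw [← hT] at s
      have ea := s (xa (k + 2))
      have eb := s (xb (k + 2))
      have e (x : ℕ → ℕ → ℂ) (j : ℕ) : F x (k + 2) j = T (x (k + 2)) j := by simp [hF]
      simp only [← e] at ea eb
      rw [show k + 4 = (k + 1) + 3 by ring, Bpoly_succ, Bpoly_succ xa xb]
      exact congrArg₂ (· * ·) ea eb
  refine ⟨F xa, F xb, T y, by simp [hF], by simp [hF], by simp [hF], by simp [hF], ?_⟩
  obtain ⟨n, rfl⟩ := Nat.exists_eq_add_of_le' hm
  have := chg_sum _ _ _ y _ _ h1 h2 h3 n (fun i a _ => key i a)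
  rw [← hT] at this
  exact this
end

section
/- Let A ∈ ℂ^{n×n}, let p ≥ 1 be an integer, and set α_p(A) = max(‖A^p‖^{1/p}, ‖A^{p+1}‖^{1/(p+1)}), where ‖·‖ is the operator norm induced by the Euclidean vector norm. Then for every integer j ≥ p(p−1), ‖A^j‖ ≤ α_p(A)^j. -/
/-- The operator norm on `n × n` complex matrices induced by the Euclidean vector norm. -/
noncomputable def opNorm {n : ℕ} (M : Matrix (Fin n) (Fin n) ℂ) : ℝ :=
  ‖Matrix.toEuclideanCLM (𝕜 := ℂ) M‖

theorem opNorm_nonneg' {n : ℕ} (M : Matrix (Fin n) (Fin n) ℂ) : 0 ≤ opNorm M :=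
  norm_nonneg _

theorem opNorm_mul_le {n : ℕ} (M N : Matrix (Fin n) (Fin n) ℂ) :
    opNorm (M * N) ≤ opNorm M * opNorm N := by
  unfold opNorm
  rw [map_mul]
  exact norm_mul_le _ _

theorem opNorm_pow_le {n : ℕ} (M : Matrix (Fin n) (Fin n) ℂ) (k : ℕ) :
    opNorm (M ^ k) ≤ opNorm M ^ k := by
  induction k with
  | zero =>
    unfold opNorm
    rw [pow_zero, pow_zero, map_one]
    exact ContinuousLinearMap.norm_id_le
  | succ k ih =>
    rw [pow_succ, pow_succ]
    exact (opNorm_mul_le _ _).trans (mul_le_mul_of_nonneg_right ih (opNorm_nonneg' _))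

theorem exists_repr (p : ℕ) (hp : 1 ≤ p) (j : ℕ) (hj : p * (p - 1) ≤ j) :
    ∃ u v : ℕ, j = p * u + (p + 1) * v := by
  have h1 : p - 1 ≤ j / p := (Nat.le_div_iff_mul_le hp).2 (by rwa [mul_comm])
  have h2 : j % p < p := Nat.mod_lt _ hp
  obtain ⟨u, hu⟩ := Nat.exists_eq_add_of_le (show j % p ≤ j / p by omega)
  refine ⟨u, j % p, ?_⟩
  have h3 := Nat.div_add_mod j p
  rw [hu] at h3
  nlinarith

theorem pow_norm_le_alpha_pow {n : ℕ} (A : Matrix (Fin n) (Fin n) ℂ)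
    (p : ℕ) (hp : 1 ≤ p) (j : ℕ) (hj : p * (p - 1) ≤ j) :
    opNorm (A ^ j) ≤
      (max (opNorm (A ^ p) ^ ((1 : ℝ) / p))
        (opNorm (A ^ (p + 1)) ^ ((1 : ℝ) / (p + 1)))) ^ j := by
  obtain ⟨u, v, rfl⟩ := exists_repr p hp j hj
  set a := max (opNorm (A ^ p) ^ ((1 : ℝ) / p))
        (opNorm (A ^ (p + 1)) ^ ((1 : ℝ) / (p + 1))) with ha
  have h1 : opNorm (A ^ p) ≤ a ^ p := by
    have h : (opNorm (A ^ p) ^ ((1 : ℝ) / p)) ^ p = opNorm (A ^ p) := by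
      rw [one_div]
      exact Real.rpow_inv_natCast_pow (opNorm_nonneg' _) (by omega)
    rw [← h]
    exact pow_le_pow_left₀ (Real.rpow_nonneg (opNorm_nonneg' _) _) (le_max_left _ _) _
  have h2 : opNorm (A ^ (p + 1)) ≤ a ^ (p + 1) := by
    have h : (opNorm (A ^ (p + 1)) ^ ((1 : ℝ) / (p + 1))) ^ (p + 1) = opNorm (A ^ (p + 1)) := by
      rw [one_div]
      exact_mod_cast Real.rpow_inv_natCast_pow (opNorm_nonneg' (A ^ (p + 1))) (Nat.succ_ne_zero p)
    rw [← h]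
    exact pow_le_pow_left₀ (Real.rpow_nonneg (opNorm_nonneg' _) _) (le_max_right _ _) _
  rw [pow_add A (p * u), pow_mul A p, pow_mul A (p + 1), pow_add a (p * u), pow_mul a p,
    pow_mul a (p + 1)]
  have h3 := (opNorm_pow_le (A ^ p) u).trans (pow_le_pow_left₀ (opNorm_nonneg' _) h1 u)
  have h4 := (opNorm_pow_le (A ^ (p + 1)) v).trans (pow_le_pow_left₀ (opNorm_nonneg' _) h2 v)
  exact (opNorm_mul_le _ _).trans
    (mul_le_mul h3 h4 (opNorm_nonneg' _) ((opNorm_nonneg' _).trans h3))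
end

section
/- Let A ∈ ℂ^{n×n}, let p ≥ 1 and j_0 ≥ 0 be integers with p(p−1) ≤ j_0, and let (β_j)_{j≥j_0} be complex scalars such that the series Σ_{j=j_0}^∞ |β_j| α_p(A)^j converges, where α_p(A) = max(‖A^p‖^{1/p}, ‖A^{p+1}‖^{1/(p+1)}) and ‖·‖ is the operator norm induced by the Euclidean vector norm. Then the series h(A) = Σ_{j=j_0}^∞ β_j A^j converges in ℂ^{n×n} and ‖h(A)‖ ≤ Σ_{j=j_0}^∞ |β_j| α_p(A)^j. -/
theorem pow_norm_bound {R : Type*} [NormedRing R] (h1 : ‖(1 : R)‖ ≤ 1) (T : R) (p : ℕ) (hp : 1 ≤ p)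
    (α : ℝ) (h0 : 0 ≤ α) (ha : ‖T ^ p‖ ≤ α ^ p) (hb : ‖T ^ (p + 1)‖ ≤ α ^ (p + 1))
    (j : ℕ) (hj : p * (p - 1) ≤ j) : ‖T ^ j‖ ≤ α ^ j := by
  have key : ∀ (x : R) (k : ℕ), ‖x ^ k‖ ≤ ‖x‖ ^ k := by
    intro x k
    induction k with
    | zero => simpa using h1
    | succ k ih =>
      rw [pow_succ, pow_succ]
      exact (norm_mul_le _ _).trans (by gcongr)
  have hr : j % p < p := Nat.mod_lt _ hp
  have hq : p - 1 ≤ j / p := (Nat.le_div_iff_mul_le hp).2 (by rwa [mul_comm])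
  obtain ⟨c, hc⟩ : ∃ c, j / p = j % p + c := Nat.exists_eq_add_of_le (by omega)
  have e : j = p * c + (p + 1) * (j % p) := by
    have h := Nat.div_add_mod j p
    rw [hc] at h
    nlinarith
  generalize j % p = r at e
  rw [e, pow_add, pow_add, pow_mul, pow_mul, pow_mul α, pow_mul α]
  refine (norm_mul_le _ _).trans ?_
  gcongr
  · exact (key _ _).trans (by gcongr)
  · exact (key _ _).trans (by gcongr)

theorem series_norm_bound {n : ℕ} (A : Matrix (Fin n) (Fin n) ℂ)
    (p : ℕ) (hp : 1 ≤ p) (j0 : ℕ) (hj0 : p * (p - 1) ≤ j0)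
    (β : ℕ → ℂ) (α : ℝ)
    (hα : α = max (opNorm (A ^ p) ^ ((1 : ℝ) / p))
        (opNorm (A ^ (p + 1)) ^ ((1 : ℝ) / (p + 1))))
    (hsum : Summable fun j : ℕ => ‖β (j0 + j)‖ * α ^ (j0 + j)) :
    (Summable fun j : ℕ => β (j0 + j) • A ^ (j0 + j)) ∧
      opNorm (∑' j : ℕ, β (j0 + j) • A ^ (j0 + j)) ≤
        ∑' j : ℕ, ‖β (j0 + j)‖ * α ^ (j0 + j) := by
  have hnn : ∀ M : Matrix (Fin n) (Fin n) ℂ, 0 ≤ opNorm M := fun M => norm_nonneg _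
  have h0 : 0 ≤ α := by
    rw [hα]
    exact le_max_of_le_left (Real.rpow_nonneg (hnn _) _)
  have ha : opNorm (A ^ p) ≤ α ^ p := by
    have h : opNorm (A ^ p) ^ ((1 : ℝ) / p) ≤ α := hα ▸ le_max_left _ _
    calc opNorm (A ^ p) = (opNorm (A ^ p) ^ ((1 : ℝ) / p)) ^ p := by
          rw [one_div, Real.rpow_inv_natCast_pow (hnn _) (by omega)]
      _ ≤ α ^ p := pow_le_pow_left₀ (Real.rpow_nonneg (hnn _) _) h _
  have hb : opNorm (A ^ (p + 1)) ≤ α ^ (p + 1) := by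
    have h : opNorm (A ^ (p + 1)) ^ ((1 : ℝ) / (p + 1)) ≤ α := hα ▸ le_max_right _ _
    calc opNorm (A ^ (p + 1)) = (opNorm (A ^ (p + 1)) ^ ((1 : ℝ) / (p + 1))) ^ (p + 1) := by
          have := Real.rpow_inv_natCast_pow (hnn (A ^ (p + 1))) (Nat.succ_ne_zero p)
          rw [one_div]
          push_cast at this
          exact this.symm
      _ ≤ α ^ (p + 1) := pow_le_pow_left₀ (Real.rpow_nonneg (hnn _) _) h _
  unfold opNorm at ha hb
  rw [map_pow] at ha hb
  set T := Matrix.toEuclideanCLM (𝕜 := ℂ) A with hT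
  have hbd : ∀ j, ‖β (j0 + j) • T ^ (j0 + j)‖ ≤ ‖β (j0 + j)‖ * α ^ (j0 + j) := by
    intro j
    rw [norm_smul]
    gcongr
    exact pow_norm_bound ContinuousLinearMap.norm_id_le T p hp α h0 ha hb _ (by omega)
  have hS : Summable fun j => β (j0 + j) • T ^ (j0 + j) := Summable.of_norm_bounded hsum hbd
  let L := LinearMap.toContinuousLinearMap
    ((Matrix.toEuclideanCLM (n := Fin n) (𝕜 := ℂ)).symm.toAlgEquiv.toLinearMap)
  have hL : ∀ X, L X = (Matrix.toEuclideanCLM (n := Fin n) (𝕜 := ℂ)).symm X := fun X => rfl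
  have hM := L.hasSum hS.hasSum
  have hfun : (fun j => L (β (j0 + j) • T ^ (j0 + j))) = fun j => β (j0 + j) • A ^ (j0 + j) := by
    funext j
    rw [map_smul, hL, map_pow, hT, StarAlgEquiv.symm_apply_apply]
  rw [hfun] at hM
  refine ⟨hM.summable, ?_⟩
  rw [hM.tsum_eq, hL, opNorm, StarAlgEquiv.apply_symm_apply]
  exact tsum_of_norm_bounded hsum.hasSum hbd
end
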